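/- For every δ with 0 < δ < 1/3 and every sufficiently small ε > 0 there exists a finite alphabet Σ (whose size depends only on δ and ε, not on the block length) such that for infinitely many pairs of positive integers (k, n) with k/n > 1 - 3δ - ε there exists an injective encoding map E : Σ^k → Σ^n whose image has pairwise edit distance greater than 2δn; equivalently, whenever a string x satisfies ED(E(m), x) ≤ δn, the message m is uniquely determined by x, so the code can correct any δn insertions and deletions at rate greater than 1 - 3δ - ε. -/

import Mathlib

/-- Length of a longest common subsequence of `a` and `b`. -/
def lcsLen {α : Type*} [DecidableEq α] (a b : List α) : ℕ :=
  ((a.sublists.filter (fun c => decide (c.Sublist b))).map List.length).foldr max 0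

/-- Edit distance: the minimum number of single-symbol insertions and deletions
transforming one string into the other, via `ED a b = |a| + |b| - 2·LCS(a,b)`. -/
def ED {α : Type*} [DecidableEq α] (a b : List α) : ℕ :=
  a.length + b.length - 2 * lcsLen a b

/-- `substr S i j` is the substring `S[i,j)` from 1-based position `i` (inclusive)
to position `j` (exclusive). -/
def substr {α : Type*} (S : List α) (i j : ℕ) : List α :=
  (S.drop (i - 1)).take (j - i)


/-- The words of length `n` over a finite alphabet. -/
def words (α : Type*) [DecidableEq α] [Fintype α] : ℕ → Finset (List α)
  | 0 => {[]}
  | n + 1 => ((Finset.univ : Finset α) ×ˢ words α n).image fun p => p.1 :: p.2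

section Words

variable {α : Type*} [DecidableEq α] [Fintype α]

theorem mem_words {n : ℕ} {l : List α} : l ∈ words α n ↔ l.length = n := by
  induction n generalizing l with
  | zero => simp [words]
  | succ n ih =>
    cases l with
    | nil => simp [words]
    | cons a l => simp [words, ih]

theorem card_words (n : ℕ) : (words α n).card = Fintype.card α ^ n := by
  induction n with
  | zero => simp [words]
  | succ n ih =>
    rw [words, Finset.card_image_of_injective, Finset.card_product, ih, Finset.card_univ, pow_succ']
    rintro ⟨a, l⟩ ⟨b, l'⟩ h
    simpa using h

theorem card_supersequences_mul_le (n : ℕ) (c : List α) :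
    ((words α n).filter fun y => c.Sublist y).card * Fintype.card α ^ c.length
      ≤ 2 ^ n * Fintype.card α ^ n := by
  induction n generalizing c with
  | zero =>
    cases c with
    | nil => simp [words]
    | cons b c => simp [words, Finset.filter_singleton]
  | succ n ih =>
    cases c with
    | nil => simpa [card_words] using Nat.le_mul_of_pos_left _ (by positivity)
    | cons b c =>
      have hsub : ((words α (n + 1)).filter fun y => (b :: c).Sublist y) ⊆
          (((Finset.univ : Finset α) ×ˢ
            (words α n).filter fun y => (b :: c).Sublist y).image fun p => p.1 :: p.2) ∪
          (((words α n).filter fun y => c.Sublist y).image fun y => b :: y) := by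
        intro y hy
        rw [Finset.mem_filter, mem_words] at hy
        obtain ⟨hlen, hy⟩ := hy
        cases hy with
        | cons a h =>
          apply Finset.mem_union_left
          simp only [Finset.mem_image, Finset.mem_product, Finset.mem_filter, mem_words]
          exact ⟨(a, _), ⟨Finset.mem_univ _, by simpa using hlen, h⟩, rfl⟩
        | cons_cons _ h =>
          apply Finset.mem_union_right
          simp only [Finset.mem_image, Finset.mem_filter, mem_words]
          exact ⟨_, ⟨by simpa using hlen, h⟩, rfl⟩
      have hcard := (Finset.card_le_card hsub).trans (Finset.card_union_le _ _)
      have h1 := hcard.trans (Nat.add_le_add Finset.card_image_le Finset.card_image_le)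
      rw [Finset.card_product, Finset.card_univ] at h1
      have hb := ih (b :: c)
      have hc := ih c
      rw [List.length_cons] at hb ⊢
      calc _ ≤ _ := Nat.mul_le_mul_right _ h1
        _ = Fintype.card α * (((words α n).filter fun y => (b :: c).Sublist y).card *
              Fintype.card α ^ (c.length + 1)) +
            Fintype.card α * (((words α n).filter fun y => c.Sublist y).card *
              Fintype.card α ^ c.length) := by ring
        _ ≤ Fintype.card α * (2 ^ n * Fintype.card α ^ n) +
            Fintype.card α * (2 ^ n * Fintype.card α ^ n) := by gcongr
        _ = _ := by ring

/-- The words of length `n` sharing with `x` a common subsequence of length `L`. -/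
def closeWords (n L : ℕ) (x : List α) : Finset (List α) :=
  (x.sublists.toFinset.filter fun c => c.length = L).biUnion fun c =>
    (words α n).filter fun y => c.Sublist y

theorem mem_closeWords {n L : ℕ} {x y : List α} :
    y ∈ closeWords n L x ↔
      y.length = n ∧ ∃ c : List α, c.length = L ∧ c.Sublist x ∧ c.Sublist y := by
  simp only [closeWords, Finset.mem_biUnion, Finset.mem_filter, mem_words, List.mem_toFinset,
    List.mem_sublists]
  constructor
  · rintro ⟨c, ⟨h1, h2⟩, h3, h4⟩
    exact ⟨h3, c, h2, h1, h4⟩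
  · rintro ⟨h3, c, h2, h1, h4⟩
    exact ⟨c, ⟨h1, h2⟩, h3, h4⟩

theorem card_closeWords_mul_le (n L : ℕ) {x : List α} (hx : x.length = n) :
    (closeWords n L x).card * Fintype.card α ^ L ≤ 4 ^ n * Fintype.card α ^ n := by
  have hnum : (x.sublists.toFinset.filter fun c => c.length = L).card ≤ 2 ^ n := by
    refine (Finset.card_filter_le _ _).trans ((List.toFinset_card_le _).trans ?_)
    rw [List.length_sublists, hx]
  calc (closeWords n L x).card * Fintype.card α ^ L
      ≤ (∑ c ∈ x.sublists.toFinset.filter fun c => c.length = L,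
          ((words α n).filter fun y => c.Sublist y).card) * Fintype.card α ^ L :=
        Nat.mul_le_mul_right _ Finset.card_biUnion_le
    _ = ∑ c ∈ x.sublists.toFinset.filter fun c => c.length = L,
          ((words α n).filter fun y => c.Sublist y).card * Fintype.card α ^ L :=
        Finset.sum_mul _ _ _
    _ ≤ ∑ c ∈ x.sublists.toFinset.filter fun c => c.length = L, 2 ^ n * Fintype.card α ^ n := by
        refine Finset.sum_le_sum fun c hc => ?_
        rw [← (Finset.mem_filter.1 hc).2]
        exact card_supersequences_mul_le n c
    _ ≤ 2 ^ n * (2 ^ n * Fintype.card α ^ n) := by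
        rw [Finset.sum_const, smul_eq_mul]
        exact Nat.mul_le_mul_right _ hnum
    _ = 4 ^ n * Fintype.card α ^ n := by
        rw [← mul_assoc, ← mul_pow]
        norm_num

/-- Gilbert–Varshamov bound for the longest common subsequence. -/
theorem exists_code_card_mul_ge [Nonempty α] {n L : ℕ} (hL : L ≤ n) :
    ∃ C ⊆ words α n, (∀ x ∈ C, ∀ y ∈ C, x ≠ y → y ∉ closeWords n L x) ∧
      Fintype.card α ^ L ≤ C.card * 4 ^ n := by
  classical
  obtain ⟨C, hC, hmax⟩ := Finset.exists_max_image
    ((words α n).powerset.filter fun C => ∀ x ∈ C, ∀ y ∈ C, x ≠ y → y ∉ closeWords n L x)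
    Finset.card ⟨∅, by simp⟩
  rw [Finset.mem_filter, Finset.mem_powerset] at hC
  obtain ⟨hCw, hCi⟩ := hC
  refine ⟨C, hCw, hCi, ?_⟩
  have hcover : words α n ⊆ C.biUnion (closeWords n L) := by
    intro v hv
    by_contra hcon
    simp only [Finset.mem_biUnion, not_exists, not_and] at hcon
    have hvn := mem_words.1 hv
    have hvC : v ∉ C := fun h => hcon v h <| mem_closeWords.2
      ⟨hvn, v.take L, by simp [hvn, hL], List.take_sublist _ _, List.take_sublist _ _⟩
    have hins := hmax (insert v C) (by
      rw [Finset.mem_filter, Finset.mem_powerset]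
      refine ⟨Finset.insert_subset hv hCw, fun x hx y hy hxy => ?_⟩
      rw [Finset.mem_insert] at hx hy
      rcases hx with rfl | hx <;> rcases hy with rfl | hy
      · exact absurd rfl hxy
      · intro h
        obtain ⟨-, c, h1, h2, h3⟩ := mem_closeWords.1 h
        exact hcon y hy (mem_closeWords.2 ⟨hvn, c, h1, h3, h2⟩)
      · exact hcon x hx
      · exact hCi x hx y hy hxy)
    rw [Finset.card_insert_of_notMem hvC] at hins
    omega
  have hpos : 0 < Fintype.card α ^ n := pow_pos Fintype.card_pos n
  refine Nat.le_of_mul_le_mul_left ?_ hpos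
  calc Fintype.card α ^ n * Fintype.card α ^ L
      ≤ (∑ x ∈ C, (closeWords n L x).card) * Fintype.card α ^ L := by
        rw [← card_words]
        exact Nat.mul_le_mul_right _ ((Finset.card_le_card hcover).trans Finset.card_biUnion_le)
    _ = ∑ x ∈ C, (closeWords n L x).card * Fintype.card α ^ L := Finset.sum_mul _ _ _
    _ ≤ ∑ x ∈ C, 4 ^ n * Fintype.card α ^ n :=
        Finset.sum_le_sum fun x hx => card_closeWords_mul_le n L (mem_words.1 (hCw hx))
    _ = Fintype.card α ^ n * (C.card * 4 ^ n) := by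
        rw [Finset.sum_const, smul_eq_mul]
        ring

end Words

theorem exists_commonSubsequence_of_le_lcsLen {α : Type*} [DecidableEq α] {a b : List α} {L : ℕ}
    (h : L ≤ lcsLen a b) : ∃ c : List α, c.length = L ∧ c.Sublist a ∧ c.Sublist b := by
  have key : ∀ l : List (List α), (∀ c ∈ l, c.Sublist a ∧ c.Sublist b) →
      L ≤ (l.map List.length).foldr max 0 →
      ∃ c : List α, L ≤ c.length ∧ c.Sublist a ∧ c.Sublist b := by
    intro l
    induction l with
    | nil => exact fun _ hl => ⟨[], by simpa using hl, by simp, by simp⟩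
    | cons d l ih =>
      intro hall hl
      rw [List.map_cons, List.foldr_cons, le_max_iff] at hl
      rcases hl with hl | hl
      · exact ⟨d, hl, hall d (by simp)⟩
      · exact ih (fun c hc => hall c (by simp [hc])) hl
  obtain ⟨c, hc, ha, hb⟩ := key _ (by simp) h
  exact ⟨c.take L, by simp [hc], (List.take_sublist _ _).trans ha, (List.take_sublist _ _).trans hb⟩

theorem exists_encoding {m k n L : ℕ} (hm : 0 < m) (hL : L ≤ n) (hk : m ^ k * 4 ^ n ≤ m ^ L) :
    ∃ E : (Fin k → Fin m) → List (Fin m), Function.Injective E ∧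
      (∀ msg, (E msg).length = n) ∧
      ∀ msg msg', msg ≠ msg' → lcsLen (E msg) (E msg') < L := by
  have : Nonempty (Fin m) := ⟨⟨0, hm⟩⟩
  obtain ⟨C, hCw, hCi, hcard⟩ := exists_code_card_mul_ge (α := Fin m) hL
  rw [Fintype.card_fin] at hcard
  have hle : m ^ k ≤ C.card :=
    Nat.le_of_mul_le_mul_right (hk.trans hcard) (pow_pos (by norm_num) n)
  obtain ⟨f⟩ : Nonempty ((Fin k → Fin m) ↪ C) :=
    Function.Embedding.nonempty_of_card_le (by simpa using hle)
  have hinj : Function.Injective fun msg => (f msg : List (Fin m)) :=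
    Subtype.val_injective.comp f.injective
  refine ⟨fun msg => f msg, hinj, fun msg => mem_words.1 (hCw (f msg).2), fun msg msg' hne => ?_⟩
  by_contra! hlcs
  refine hCi _ (f msg).2 _ (f msg').2 (hinj.ne hne) (mem_closeWords.2 ⟨?_, ?_⟩)
  · exact mem_words.1 (hCw (f msg').2)
  · exact exists_commonSubsequence_of_le_lcsLen hlcs

/-- For every `0 < δ < 1/3` and every sufficiently small `ε > 0` there is a
finite alphabet `Σ` (of size depending only on `δ` and `ε`) such that for
infinitely many pairs `(k, n)` of positive integers with `k/n > 1 - 3δ - ε`,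
there is an injective encoding `E : Σ^k → Σⁿ` whose image has pairwise edit
distance greater than `2δn`; such a code corrects any `δn` insertions and
deletions at rate greater than `1 - 3δ - ε`. -/
theorem stmt_19 (δ : ℝ) (hδ0 : 0 < δ) (hδ1 : δ < 1 / 3) :
    ∃ ε₀ : ℝ, 0 < ε₀ ∧ ∀ ε : ℝ, 0 < ε → ε < ε₀ →
      ∃ m : ℕ,
        {p : ℕ × ℕ | 0 < p.1 ∧ 0 < p.2 ∧ (p.1 : ℝ) / p.2 > 1 - 3 * δ - ε ∧
          ∃ E : (Fin p.1 → Fin m) → List (Fin m),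
            Function.Injective E ∧
            (∀ msg, (E msg).length = p.2) ∧
            ∀ msg msg', msg ≠ msg' →
              (ED (E msg) (E msg') : ℝ) > 2 * δ * p.2}.Infinite := by
  refine ⟨1, one_pos, fun ε hε _ => ?_⟩
  obtain ⟨r, hr⟩ := exists_nat_ge (1 / δ)
  have hrδ : 1 ≤ r * δ := (div_le_iff₀ hδ0).1 hr
  have hr0 : 0 < r := by
    rcases Nat.eq_zero_or_pos r with rfl | h
    · norm_num at hrδ
    · exact h
  refine ⟨4 ^ r, Set.infinite_of_injective_forall_mem
    (f := fun i : ℕ => (⌈(1 - 3 * δ) * ((i + r : ℕ) : ℝ)⌉₊, i + r)) ?_ fun i => ?_⟩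
  · intro i j h
    simpa using congrArg Prod.snd h
  set n := i + r
  have hn0 : 0 < n := by omega
  have hnR : (0 : ℝ) < n := by exact_mod_cast hn0
  have hrate : 0 < (1 - 3 * δ) * n := mul_pos (by linarith) hnR
  have hδn : 1 ≤ δ * n := by
    have : (r : ℝ) ≤ n := by exact_mod_cast (by omega : r ≤ n)
    nlinarith
  have hk1 := Nat.le_ceil ((1 - 3 * δ) * (n : ℝ))
  have hk2 := Nat.ceil_lt_add_one hrate.le
  have hL1 := Nat.le_ceil ((1 - δ) * (n : ℝ))
  have hLn : ⌈(1 - δ) * (n : ℝ)⌉₊ ≤ n := Nat.ceil_le.2 (by nlinarith)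
  set k := ⌈(1 - 3 * δ) * (n : ℝ)⌉₊
  set L := ⌈(1 - δ) * (n : ℝ)⌉₊
  have hexp : r * k + n ≤ r * L := by
    have hkL : δ * n ≤ (L : ℝ) - k := by nlinarith
    have h : (n : ℝ) ≤ r * ((L : ℝ) - k) := by
      calc (n : ℝ) ≤ (r * δ) * n := le_mul_of_one_le_left hnR.le hrδ
        _ = r * (δ * n) := by ring
        _ ≤ _ := by gcongr
    have : (r : ℝ) * k + n ≤ r * L := by linarith
    exact_mod_cast this
  obtain ⟨E, hE, hlen, hlcs⟩ := exists_encoding (m := 4 ^ r) (k := k) (by positivity) hLn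
    (by rw [← pow_mul, ← pow_mul, ← pow_add]; exact Nat.pow_le_pow_right (by norm_num) hexp)
  refine ⟨Nat.ceil_pos.2 hrate, hn0, ?_, E, hE, hlen, fun msg msg' hne => ?_⟩
  · have : 1 - 3 * δ ≤ (k : ℝ) / n := (le_div_iff₀ hnR).2 hk1
    change (k : ℝ) / n > 1 - 3 * δ - ε
    linarith
  · have hlt := hlcs msg msg' hne
    have hltR := Nat.lt_ceil.1 hlt
    have hED : ED (E msg) (E msg') + 2 * lcsLen (E msg) (E msg') = 2 * n := by
      rw [ED, hlen, hlen]
      omega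
    have hEDR : (ED (E msg) (E msg') : ℝ) + 2 * lcsLen (E msg) (E msg') = 2 * n := by
      exact_mod_cast hED
    change (ED (E msg) (E msg') : ℝ) > 2 * δ * n
    linarith
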